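/- arXiv:2302.02339 — 3 statements merged into one kernel-verified Lean document; each statement's English description precedes it below -/
import Mathlib

section
/- Suppose that the zero sets of $f_1, \dots, f_l$ are pairwise disjoint (for every $x \in \mathbb{R}^k$ at most one index $j$ has $f_j(x) = 0$) and that for every $j$ and every $x$ with $f_j(x) = 0$ the Fréchet derivative of $f_j$ at $x$ is nonzero. Then $0$ is a regular value of $F(x,y) := \prod_{j=1}^l f_j(x) - \sum_{j=1}^{k'} y_j^2$: for every $(x,y) \in \mathbb{R}^k \times \mathbb{R}^{k'}$ with $F(x,y) = 0$, the Fréchet derivative of $F$ at $(x,y)$ is nonzero (equivalently, surjective onto $\mathbb{R}$). -/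
open scoped BigOperators

theorem stmt_3 {k k' l : ℕ} (hk : 0 < k) (hk' : 0 < k') (hl : 0 < l)
    (f : Fin l → (Fin k → ℝ) → ℝ) (hf : ∀ j, ContDiff ℝ (⊤ : ℕ∞) (f j))
    (hdisj : ∀ x : Fin k → ℝ, ∀ i j : Fin l, f i x = 0 → f j x = 0 → i = j)
    (hreg : ∀ j : Fin l, ∀ x : Fin k → ℝ, f j x = 0 → fderiv ℝ (f j) x ≠ 0)
    (F : (Fin k → ℝ) × (Fin k' → ℝ) → ℝ)
    (hF : F = fun p => (∏ j, f j p.1) - ∑ j, (p.2 j) ^ 2) :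
    ∀ p : (Fin k → ℝ) × (Fin k' → ℝ), F p = 0 → fderiv ℝ F p ≠ 0 := by
  classical
  rintro ⟨x, y⟩ hp hzero
  have hdiff : ∀ j, DifferentiableAt ℝ (f j) x := fun j =>
    (hf j).differentiable (by simp) x
  have hprod : HasFDerivAt (fun p : (Fin k → ℝ) × (Fin k' → ℝ) => ∏ j, f j p.1)
      (∑ i, (∏ j ∈ Finset.univ.erase i, f j x) •
        (fderiv ℝ (f i) x).comp (ContinuousLinearMap.fst ℝ (Fin k → ℝ) (Fin k' → ℝ))) (x, y) :=
    HasFDerivAt.finsetProd (u := Finset.univ)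
      (g := fun j (p : (Fin k → ℝ) × (Fin k' → ℝ)) => f j p.1) fun i _ =>
      HasFDerivAt.comp (x, y) (f := Prod.fst) (hdiff i).hasFDerivAt hasFDerivAt_fst
  have hsum : HasFDerivAt (fun p : (Fin k → ℝ) × (Fin k' → ℝ) => ∑ j, (p.2 j) ^ 2)
      (∑ j, (2 * y j) • (ContinuousLinearMap.proj (R := ℝ) (φ := fun _ : Fin k' => ℝ) j).comp
        (ContinuousLinearMap.snd ℝ (Fin k → ℝ) (Fin k' → ℝ))) (x, y) := by
    refine HasFDerivAt.fun_sum fun j _ => ?_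
    have h := (((ContinuousLinearMap.proj (R := ℝ) (φ := fun _ : Fin k' => ℝ) j).comp
      (ContinuousLinearMap.snd ℝ (Fin k → ℝ) (Fin k' → ℝ))).hasFDerivAt (x := (x, y))).pow 2
    simpa using h
  rw [hF, (hprod.fun_sub hsum).fderiv] at hzero
  have hy : ∑ j, y j ^ 2 = 0 := by
    have h := DFunLike.congr_fun hzero (0, y)
    simp [mul_assoc, ← Finset.mul_sum, ← pow_two] at h
    exact h
  have hx : ∏ j, f j x = 0 := by
    simpa [hF, hy] using hp
  obtain ⟨i, -, hi⟩ := Finset.prod_eq_zero_iff.mp hx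
  refine hreg i x hi (ContinuousLinearMap.ext fun v => ?_)
  have h := DFunLike.congr_fun hzero (v, 0)
  simp only [sub_apply, sum_apply,
    smul_apply, ContinuousLinearMap.comp_apply,
    ContinuousLinearMap.coe_fst', ContinuousLinearMap.coe_snd', map_zero, smul_eq_mul, mul_zero,
    Finset.sum_const_zero, sub_zero, zero_apply] at h
  rw [Finset.sum_eq_single i] at h
  · refine (mul_eq_zero.mp h).resolve_left (Finset.prod_ne_zero_iff.mpr fun j hj hj0 => ?_)
    exact Finset.ne_of_mem_erase hj (hdisj x j i hj0 hi)
  · intro j _ hji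
    rw [Finset.prod_eq_zero (Finset.mem_erase.mpr ⟨hji.symm, Finset.mem_univ i⟩) hi, zero_mul]
  · simp
end

section
/- Suppose that the zero sets of $f_1, \dots, f_l$ are pairwise disjoint and that the Fréchet derivative of each $f_j$ is nonzero at every zero of $f_j$. Then every point $p$ of $M := F^{-1}(0)$, where $F(x,y) := \prod_{j=1}^l f_j(x) - \sum_{j=1}^{k'} y_j^2$ on $\mathbb{R}^k \times \mathbb{R}^{k'} = \mathbb{R}^{k_0}$, has an open neighborhood in the subspace topology of $M$ that is homeomorphic to an open subset of $\mathbb{R}^{k_0 - 1}$; that is, $M$ is a topological manifold of dimension $k_0 - 1 = k + k' - 1$ without boundary. -/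
open scoped BigOperators

/-- A slice `{x | (e x).1 = c}` of a partial homeomorphism into a product is, near each point of
the source of `e`, homeomorphic to an open subset of the second factor. -/
theorem exists_isOpen_homeomorph_slice {E G H : Type*} [TopologicalSpace E] [TopologicalSpace G]
    [TopologicalSpace H] (e : OpenPartialHomeomorph E (G × H)) {f : E → G}
    (hfst : ∀ x, (e x).1 = f x) {c : G} (a : ↥(f ⁻¹' {c})) (ha : (a : E) ∈ e.source) :
    ∃ U : Set ↥(f ⁻¹' {c}), IsOpen U ∧ a ∈ U ∧
      ∃ V : Set H, IsOpen V ∧ Nonempty (↥U ≃ₜ ↥V) := by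
  have pair (x : ↥(f ⁻¹' {c})) : (c, (e x).2) = e x := Prod.ext ((hfst x).trans x.2).symm rfl
  refine ⟨Subtype.val ⁻¹' e.source, e.open_source.preimage continuous_subtype_val, ha,
    (fun v => (c, v)) ⁻¹' e.target, e.open_target.preimage (by fun_prop), ⟨?_⟩⟩
  exact
    { toFun := fun x => ⟨(e x.1).2, by
        change (c, (e x.1).2) ∈ e.target
        rw [pair]
        exact e.map_source x.2⟩
      invFun := fun v => ⟨⟨e.symm (c, v), by
        change f _ = c
        rw [← hfst, e.right_inv v.2]⟩, e.map_target v.2⟩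
      left_inv := fun x => by
        ext
        change e.symm (c, (e x.1).2) = x.1
        rw [pair, e.left_inv x.2]
      right_inv := fun v => by
        ext
        change (e (e.symm (c, v))).2 = v
        rw [e.right_inv v.2]
      continuous_toFun := by
        refine Continuous.subtype_mk (continuous_snd.comp ?_) _
        exact e.continuousOn.comp_continuous
          (continuous_subtype_val.comp continuous_subtype_val) fun x => x.2
      continuous_invFun := by
        refine Continuous.subtype_mk (Continuous.subtype_mk ?_ _) _
        exact e.symm.continuousOn.comp_continuous
          (continuous_const.prodMk continuous_subtype_val) fun v => v.2 }

/-- A level set of a real function is locally Euclidean of codimension one at every point where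
the function has a nonzero strict derivative. -/
theorem HasStrictFDerivAt.exists_isOpen_homeomorph_levelSet {E : Type*} [NormedAddCommGroup E]
    [NormedSpace ℝ E] [FiniteDimensional ℝ E] {f : E → ℝ} {f' : E →L[ℝ] ℝ} {c : ℝ}
    (a : ↥(f ⁻¹' {c})) (hf : HasStrictFDerivAt f f' a) (hf' : f' ≠ 0) :
    ∃ U : Set ↥(f ⁻¹' {c}), IsOpen U ∧ a ∈ U ∧
      ∃ V : Set (Fin (Module.finrank ℝ E - 1) → ℝ), IsOpen V ∧ Nonempty (↥U ≃ₜ ↥V) := by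
  have : CompleteSpace E := FiniteDimensional.complete ℝ E
  have hne : (f' : E →ₗ[ℝ] ℝ) ≠ 0 := fun h => hf' (ContinuousLinearMap.coe_injective h)
  have hrange : f'.range = ⊤ := LinearMap.range_eq_top.2 (LinearMap.surjective hne)
  have hker : Module.finrank ℝ f'.ker = Module.finrank ℝ E - 1 := by
    have h := LinearMap.finrank_range_add_finrank_ker (f' : E →ₗ[ℝ] ℝ)
    rw [hrange, finrank_top, Module.finrank_self] at h
    omega
  let L : f'.ker ≃L[ℝ] (Fin (Module.finrank ℝ E - 1) → ℝ) :=
    ContinuousLinearEquiv.ofFinrankEq (by simp [hker])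
  obtain ⟨U, hU, haU, V, hV, ⟨h⟩⟩ := exists_isOpen_homeomorph_slice
    (hf.implicitToOpenPartialHomeomorph f f' hrange)
    (hf.implicitToOpenPartialHomeomorph_fst hrange) a
    (hf.mem_implicitToOpenPartialHomeomorph_source hrange)
  exact ⟨U, hU, haU, L.toHomeomorph '' V, L.toHomeomorph.isOpenMap V hV,
    ⟨h.trans (L.toHomeomorph.image V)⟩⟩

/-- The Leibniz expression for the derivative of a product does not vanish at a zero of exactly one
factor, if the derivative of that factor is nonzero. -/
theorem sum_prod_erase_smul_ne_zero {V ι : Type*} [AddCommGroup V] [Module ℝ V] [Fintype ι]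
    [DecidableEq ι] {c : ι → ℝ} {v : ι → V} (hdisj : ∀ i j, c i = 0 → c j = 0 → i = j)
    (hreg : ∀ j, c j = 0 → v j ≠ 0) (hc : ∏ j, c j = 0) :
    ∑ i, (∏ j ∈ Finset.univ.erase i, c j) • v i ≠ 0 := by
  obtain ⟨i, -, hi⟩ := Finset.prod_eq_zero_iff.1 hc
  rw [Finset.sum_eq_single i]
  · refine smul_ne_zero (Finset.prod_ne_zero_iff.2 fun j hj hj0 => ?_) (hreg i hi)
    exact Finset.ne_of_mem_erase hj (hdisj j i hj0 hi)
  · intro b _ hb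
    rw [Finset.prod_eq_zero (Finset.mem_erase.2 ⟨hb.symm, Finset.mem_univ i⟩) hi, zero_smul]
  · simp

/-- The strict derivative of the sum of the squares of the coordinates. -/
theorem hasStrictFDerivAt_sum_sq {ι : Type*} [Fintype ι] (y : ι → ℝ) :
    HasStrictFDerivAt (fun y : ι → ℝ => ∑ j, y j ^ 2)
      (∑ j, (2 * y j) • ContinuousLinearMap.proj (R := ℝ) (φ := fun _ : ι => ℝ) j) y := by
  refine HasStrictFDerivAt.fun_sum fun j _ => ?_
  simpa using (hasStrictFDerivAt_apply (𝕜 := ℝ) j y).pow 2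

theorem stmt_10 {k k' l : ℕ} (hk : 0 < k) (hk' : 0 < k') (hl : 0 < l)
    (f : Fin l → (Fin k → ℝ) → ℝ) (hf : ∀ j, ContDiff ℝ (⊤ : ℕ∞) (f j))
    (hdisj : ∀ x : Fin k → ℝ, ∀ i j : Fin l, f i x = 0 → f j x = 0 → i = j)
    (hreg : ∀ j : Fin l, ∀ x : Fin k → ℝ, f j x = 0 → fderiv ℝ (f j) x ≠ 0)
    (F : (Fin k → ℝ) × (Fin k' → ℝ) → ℝ)
    (hF : F = fun p => (∏ j, f j p.1) - ∑ j, (p.2 j) ^ 2)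
    (M : Set ((Fin k → ℝ) × (Fin k' → ℝ))) (hM : M = F ⁻¹' {0}) :
    ∀ p : ↥M, ∃ U : Set ↥M, IsOpen U ∧ p ∈ U ∧
      ∃ V : Set (Fin (k + k' - 1) → ℝ), IsOpen V ∧ Nonempty (↥U ≃ₜ ↥V) := by
  subst hM
  rintro ⟨⟨x, y⟩, hp⟩
  have hfx (j : Fin l) : HasStrictFDerivAt (f j) (fderiv ℝ (f j) x) x :=
    (hf j).contDiffAt.hasStrictFDerivAt (by simp)
  have hP := HasStrictFDerivAt.finsetProd (u := Finset.univ) fun j _ => hfx j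
  have hFd := (hP.comp (x, y) (hasStrictFDerivAt_fst (𝕜 := ℝ) (p := (x, y)))).sub
    ((hasStrictFDerivAt_sum_sq y).comp (x, y) (hasStrictFDerivAt_snd (𝕜 := ℝ) (p := (x, y))))
  replace hFd : HasStrictFDerivAt F _ (x, y) :=
    hFd.congr_of_eventuallyEq (.of_forall fun p => by simp [hF])
  have hdim : Module.finrank ℝ ((Fin k → ℝ) × (Fin k' → ℝ)) = k + k' := by simp
  rw [← hdim]
  refine HasStrictFDerivAt.exists_isOpen_homeomorph_levelSet ⟨(x, y), hp⟩ hFd fun h0 => ?_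
  by_cases hy : y = 0
  · have hx : ∏ j, f j x = 0 := by simpa [hF, hy] using hp
    refine sum_prod_erase_smul_ne_zero (hdisj x) (fun j => hreg j x) hx ?_
    ext v
    simpa using DFunLike.congr_fun h0 (v, 0)
  · obtain ⟨j, hj⟩ := Function.ne_iff.1 hy
    have h := DFunLike.congr_fun h0 (0, Pi.single j 1)
    simp [Pi.single_apply] at h
    exact hj h
end

section
/- Assume $k' \geq 2$ and that the set $E := \{x \in \mathbb{R}^k : f_j(x) \geq 0 \text{ for all } j\}$ is compact, where each $f_j$ is continuous. Let $M_D := \{(x,y) \in E \times \mathbb{R}^{k'} : \prod_{j=1}^l f_j(x) = \sum_{j=1}^{k'} y_j^2\}$ and let $P : M_D \to E$ be the restriction of the projection $(x,y) \mapsto x$. Then for every $t \in \mathbb{R}$, the map $P$ induces a bijection between the set of connected components of $\{(x,y) \in M_D : x_1 = t\}$ and the set of connected components of $\{x \in E : x_1 = t\}$, where $x_1$ denotes the first coordinate of $x$. -/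
open scoped BigOperators

theorem isConnected_setOf_sum_sq_eq {n : ℕ} (hn : 2 ≤ n) {c : ℝ} (hc : 0 ≤ c) :
    IsConnected {y : Fin n → ℝ | c = ∑ j, (y j) ^ 2} := by
  have hrank : 1 < Module.rank ℝ (EuclideanSpace ℝ (Fin n)) := by
    rw [← Module.finrank_eq_rank, finrank_euclideanSpace_fin]
    exact_mod_cast hn
  have hsphere := (isConnected_sphere hrank 0 (Real.sqrt_nonneg c)).image
    (WithLp.ofLp : EuclideanSpace ℝ (Fin n) → Fin n → ℝ)
    (PiLp.continuous_ofLp 2 _).continuousOn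
  convert hsphere using 1
  ext y
  rw [EuclideanSpace.sphere_zero_eq _ (Real.sqrt_nonneg c), Real.sq_sqrt hc]
  constructor
  · intro hy
    exact ⟨WithLp.toLp 2 y, Eq.symm hy, rfl⟩
  · rintro ⟨x, hx, rfl⟩
    exact Eq.symm hx

theorem stmt_12 {k k' l : ℕ} (hk : 0 < k) (hk' : 2 ≤ k') (hl : 0 < l)
    (f : Fin l → (Fin k → ℝ) → ℝ) (hf : ∀ j, Continuous (f j))
    (E : Set (Fin k → ℝ)) (hE : E = {x | ∀ j : Fin l, 0 ≤ f j x})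
    (hEc : IsCompact E) (t : ℝ) :
    ∃ e : ConnectedComponents ↥{p : (Fin k → ℝ) × (Fin k' → ℝ) |
            (p.1 ∈ E ∧ (∏ j, f j p.1) = ∑ j, (p.2 j) ^ 2) ∧ p.1 ⟨0, hk⟩ = t} ≃
          ConnectedComponents ↥{x : Fin k → ℝ | x ∈ E ∧ x ⟨0, hk⟩ = t},
      ∀ p : ↥{p : (Fin k → ℝ) × (Fin k' → ℝ) |
            (p.1 ∈ E ∧ (∏ j, f j p.1) = ∑ j, (p.2 j) ^ 2) ∧ p.1 ⟨0, hk⟩ = t},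
        e (ConnectedComponents.mk p) =
          ConnectedComponents.mk
            (⟨p.val.1, ⟨p.prop.1.1, p.prop.2⟩⟩ :
              ↥{x : Fin k → ℝ | x ∈ E ∧ x ⟨0, hk⟩ = t}) := by
  subst hE
  set X := {p : (Fin k → ℝ) × (Fin k' → ℝ) |
    (p.1 ∈ {x | ∀ j : Fin l, 0 ≤ f j x} ∧ (∏ j, f j p.1) = ∑ j, (p.2 j) ^ 2) ∧
      p.1 ⟨0, hk⟩ = t}
  set B := {x : Fin k → ℝ | x ∈ {x | ∀ j : Fin l, 0 ≤ f j x} ∧ x ⟨0, hk⟩ = t}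
  let P : X → B := fun p ↦ ⟨p.val.1, ⟨p.prop.1.1, p.prop.2⟩⟩
  have hP : Continuous P := by fun_prop
  have hprod (x : B) : 0 ≤ ∏ j, f j x.1 := Finset.prod_nonneg fun j _ ↦ x.2.1 j
  let i₀ : Fin k' := ⟨0, by lia⟩
  let s : B → X := fun x ↦ ⟨(x.1, Pi.single i₀ √(∏ j, f j x.1)), ⟨x.2.1, by
    simp [Pi.single_apply, ite_pow, Real.sq_sqrt (hprod x)]⟩, x.2.2⟩
  have hs : Continuous s := by
    refine Continuous.subtype_mk (continuous_subtype_val.prodMk ?_) _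
    exact (continuous_single i₀).comp (by fun_prop)
  have hquot : Topology.IsQuotientMap P := .of_inverse hs hP fun _ ↦ rfl
  have hfib (x : B) : IsConnected (P ⁻¹' {x}) := by
    have hy := (isConnected_setOf_sum_sq_eq hk' (hprod x)).image (Prod.mk x.1) (by fun_prop)
    refine ⟨⟨s x, rfl⟩, Topology.IsInducing.subtypeVal.isPreconnected_image.1 ?_⟩
    convert hy.isPreconnected using 1
    ext q
    constructor
    · rintro ⟨p, rfl, rfl⟩
      exact ⟨_, p.2.1.2, rfl⟩
    · rintro ⟨y, hy, rfl⟩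
      exact ⟨⟨(x.1, y), ⟨x.2.1, hy⟩, x.2.2⟩, rfl, rfl⟩
  exact ⟨Equiv.ofBijective _ (hquot.isCoinducing.connectedComponentsMap_bijective hfib),
    fun _ ↦ rfl⟩
end
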